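/- Let Θ ⊂ ℝ³ be a compact set, Ω = ℝ³ ∖ Θ, and let Ψ : ℝ³ → [0,1] be a C^∞ function with bounded derivatives of all orders, Ψ = 0 on a neighborhood of Θ, and Ψ = 1 outside a compact set. Let Q : ℝ³ → ℝ be a C² positive radial function solving −Q + ΔQ + Q³ = 0 on ℝ³, with constants a, C₀ > 0 such that for all |x| > 1: |Q(x) − (a/|x|)e^{−|x|}| ≤ C₀ e^{−|x|}/|x|^{3/2} and |∇Q(x)| + |∇²Q(x)| ≤ C₀ e^{−|x|}/|x|. Then there exist ε₀ > 0, η₀ > 0 and R₀ > 0 such that for every X₀ ∈ ℝ³ with |X₀| ≥ R₀ and every u ∈ H¹₀(Ω) with ‖u − Q(·−X₀)Ψ‖_{H¹(ℝ³)} < ε₀, there exists a unique pair (X, μ) ∈ ℝ³ × ℝ with |μ| + |X − X₀| ≤ η₀ satisfying the orthogonality conditions: Re ∫_Ω u(x) ∂_{x_k}(Q(x−X)Ψ(x)) e^{−iμ} dx = 0 for k = 1,2,3, and Im ∫_Ω u(x) Q(x−X)Ψ(x) e^{−iμ} dx = 0. -/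

import Mathlib

noncomputable section

open MeasureTheory Real

abbrev R3 : Type := EuclideanSpace ℝ (Fin 3)

/-- The Euclidean Laplacian of a real-valued function on ℝ³. -/
def lap (f : R3 → ℝ) (x : R3) : ℝ :=
  ∑ i : Fin 3,
    fderiv ℝ (fun y => fderiv ℝ f y (EuclideanSpace.single i 1)) x (EuclideanSpace.single i 1)

/-- Membership of (the extension by zero of) a function in H¹₀(Ω), Ω = ℝ³ ∖ Θ. -/
def MemH10 (Θ : Set R3) (u : R3 → ℂ) : Prop :=
  Differentiable ℝ u ∧ Integrable (fun x => ‖u x‖ ^ 2) ∧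
    Integrable (fun x => ‖fderiv ℝ u x‖ ^ 2) ∧
    (∀ᵐ x : R3, x ∈ Θ → u x = 0)

/-- Square of the H¹(ℝ³) norm. -/
def H1sq (u : R3 → ℂ) : ℝ := (∫ x : R3, ‖u x‖ ^ 2) + ∫ x : R3, ‖fderiv ℝ u x‖ ^ 2


lemma fp_aux (Φ : R3 × ℝ → R3 × ℝ) (A : (R3 × ℝ) ≃L[ℝ] (R3 × ℝ)) (β κ η : ℝ) (X₀ : R3)
    (hη : 0 < η)
    (hβ : ∀ z, ‖A.symm z‖ ≤ β * ‖z‖) (hβ0 : 0 ≤ β) (hβκ : β * κ ≤ 1 / 8)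
    (hΦ : ∀ P P' : R3 × ℝ, |P.2| + ‖P.1 - X₀‖ ≤ η → |P'.2| + ‖P'.1 - X₀‖ ≤ η →
      ‖Φ P - Φ P' - A (P - P')‖ ≤ κ * ‖P - P'‖)
    (h0 : β * ‖Φ (X₀, 0)‖ ≤ η / 8) :
    ∃! P : R3 × ℝ, |P.2| + ‖P.1 - X₀‖ ≤ η ∧ Φ P = 0 := by
  set S : Set (R3 × ℝ) := {P | |P.2| + ‖P.1 - X₀‖ ≤ η} with hS
  have hcl : IsClosed S := by
    apply isClosed_le <;> fun_prop
  let F : R3 × ℝ → R3 × ℝ := fun P => P - A.symm (Φ P)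
  have hF : ∀ P ∈ S, ∀ P' ∈ S, ‖F P - F P'‖ ≤ 1 / 8 * ‖P - P'‖ := by
    intro P hP P' hP'
    have e : F P - F P' = - A.symm (Φ P - Φ P' - A (P - P')) := by
      simp only [F, map_sub, ContinuousLinearEquiv.symm_apply_apply]
      abel
    rw [e, norm_neg]
    calc _ ≤ β * ‖Φ P - Φ P' - A (P - P')‖ := hβ _
      _ ≤ β * (κ * ‖P - P'‖) := by gcongr; exact hΦ P P' hP hP'
      _ = (β * κ) * ‖P - P'‖ := by ring
      _ ≤ _ := by gcongr
  have hS0 : (X₀, (0:ℝ)) ∈ S := by simp [hS, hη.le]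
  have hmaps : Set.MapsTo F S S := by
    intro P hP
    have h1 := hF P hP _ hS0
    have h2 : ‖P - (X₀, 0)‖ ≤ η := by
      have hP' : |P.2| + ‖P.1 - X₀‖ ≤ η := hP
      rw [Prod.norm_def]
      simp only [Prod.fst_sub, Prod.snd_sub, sub_zero, Real.norm_eq_abs]
      apply max_le <;> linarith [abs_nonneg P.2, norm_nonneg (P.1 - X₀)]
    have h3 : ‖F (X₀, 0) - (X₀, 0)‖ ≤ η / 8 := by
      have : F (X₀, 0) - (X₀, 0) = - A.symm (Φ (X₀, 0)) := by simp [F]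
      rw [this, norm_neg]
      exact (hβ _).trans h0
    have h4 : ‖F P - (X₀, 0)‖ ≤ η / 4 := by
      have : F P - (X₀, 0) = (F P - F (X₀, 0)) + (F (X₀, 0) - (X₀, 0)) := by abel
      rw [this]
      refine (norm_add_le _ _).trans ?_
      linarith
    have h5 := norm_fst_le (F P - (X₀, 0))
    have h6 := norm_snd_le (F P - (X₀, 0))
    simp only [Prod.fst_sub, Prod.snd_sub, sub_zero, Real.norm_eq_abs] at h5 h6
    show |(F P).2| + ‖(F P).1 - X₀‖ ≤ η
    linarith
  have hfix : ∀ P, F P = P ↔ Φ P = 0 := by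
    intro P
    simp [F]
  have hc : ContractingWith (1 / 8 : NNReal) (hmaps.restrict F S S) := by
    refine ⟨by rw [div_lt_one] <;> norm_num, ?_⟩
    apply LipschitzWith.of_dist_le_mul
    intro x y
    rw [Subtype.dist_eq, Subtype.dist_eq, dist_eq_norm, dist_eq_norm]
    simpa using hF x x.2 y y.2
  obtain ⟨P, hP, hPf, -⟩ := hc.exists_fixedPoint' hcl.isComplete hmaps hS0 (edist_ne_top _ _)
  refine ⟨P, ⟨hP, (hfix P).1 hPf⟩, ?_⟩
  rintro P' ⟨hP', hz⟩
  have h1 := hF P' hP' P hP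
  rw [(hfix P').2 hz, hPf] at h1
  have : ‖P' - P‖ = 0 := by linarith [norm_nonneg (P' - P)]
  exact sub_eq_zero.1 (norm_eq_zero.1 this)

lemma cos_lip (η μ ν : ℝ) (hμ : |μ| ≤ η) (hν : |ν| ≤ η) :
    |Real.cos μ - Real.cos ν| ≤ η * |μ - ν| := by
  have := (convex_Icc (-η) η).norm_image_sub_le_of_norm_deriv_le (f := Real.cos) (C := η)
    (fun x _ => Real.differentiable_cos x) (fun x hx => by
      rw [Real.deriv_cos, norm_neg, Real.norm_eq_abs]
      exact Real.abs_sin_le_abs.trans (abs_le.2 hx)) (abs_le.1 hν) (abs_le.1 hμ)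
  simpa using this

lemma sin_lip (η μ ν : ℝ) (hη1 : η ≤ 1) (hμ : |μ| ≤ η) (hν : |ν| ≤ η) :
    |Real.sin μ - Real.sin ν - (μ - ν)| ≤ η * |μ - ν| := by
  have := (convex_Icc (-η) η).norm_image_sub_le_of_norm_hasDerivWithin_le
    (f := fun x => Real.sin x - x) (f' := fun x => Real.cos x - 1) (C := η)
    (fun x _ => ((Real.hasDerivAt_sin x).sub (hasDerivAt_id x)).hasDerivWithinAt) (fun x hx => by
      have h1 := Real.one_sub_sq_div_two_le_cos (x := x)
      have h2 := Real.cos_le_one x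
      rw [Real.norm_eq_abs, abs_le]
      have h3 : |x| ≤ η := abs_le.2 hx
      have h4 : x ^ 2 ≤ η := by
        rw [← sq_abs]; nlinarith [abs_nonneg x]
      constructor <;> nlinarith) (abs_le.1 hν) (abs_le.1 hμ)
  simp only [Real.norm_eq_abs] at this
  convert this using 2
  ring

lemma R3_norm_le (z : R3) (t : ℝ) (ht : 0 ≤ t) (h : ∀ k, |z k| ≤ t) : ‖z‖ ≤ 2 * t := by
  rw [EuclideanSpace.norm_eq, Fin.sum_univ_three]
  apply Real.sqrt_le_iff.2 ⟨by positivity, ?_⟩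
  simp only [Real.norm_eq_abs]
  nlinarith [pow_le_pow_left₀ (abs_nonneg _) (h 0) 2, pow_le_pow_left₀ (abs_nonneg _) (h 1) 2,
    pow_le_pow_left₀ (abs_nonneg _) (h 2) 2]

lemma abs_mul_le' {a b A B : ℝ} (h : |a| ≤ A) (h' : |b| ≤ B) : |a * b| ≤ A * B := by
  rw [abs_mul]
  exact mul_le_mul h h' (abs_nonneg _) ((abs_nonneg _).trans h)

lemma est_k {C η δ ε d μ ν x1 x2 y1 y2 z1 z2 l : ℝ} (hC : 1 ≤ C) (hη : 0 < η) (hη1 : η ≤ 1)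
    (hδ : 0 < δ) (hε : 0 < ε) (hε1 : ε ≤ 1) (hμ : |μ| ≤ η) (hν : |ν| ≤ η) (hd : |μ - ν| ≤ d)
    (hx1 : |x1| ≤ C * C) (hy1 : |y1| ≤ C * ε) (hz1 : |z1| ≤ C * ε)
    (hx : |x1 - x2| ≤ C * C * d) (hy : |y1 - y2| ≤ C * ε * d) (hz : |z1 - z2| ≤ C * ε * d)
    (hl : |x1 - x2 - l| ≤ C * (η + δ) * d) :
    |(Real.cos μ * (x1 + y1) + Real.sin μ * z1) - (Real.cos ν * (x2 + y2) + Real.sin ν * z2) - l|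
      ≤ C ^ 2 * (6 * η + δ + 3 * ε) * d := by
  have hd0 : 0 ≤ d := (abs_nonneg _).trans hd
  have c1 : |Real.cos μ - Real.cos ν| ≤ η * d := (cos_lip η μ ν hμ hν).trans (by gcongr)
  have c2 : |Real.cos ν - 1| ≤ η := by
    have := cos_lip η ν 0 hν (by simpa using hη.le)
    rw [Real.cos_zero, sub_zero] at this
    nlinarith [abs_nonneg ν]
  have s1 : |Real.sin μ - Real.sin ν| ≤ d := by
    refine le_trans ?_ hd
    simpa [Real.dist_eq] using Real.lipschitzWith_sin.dist_le_mul μ ν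
  have t1 := abs_mul_le' c1 (show |x1 + y1| ≤ C * C + C * ε from (abs_add_le _ _).trans (by linarith))
  have t2 := abs_mul_le' c2 hx
  have t3 := abs_mul_le' (Real.abs_cos_le_one ν) hy
  have t4 := abs_mul_le' s1 hz1
  have t5 := abs_mul_le' (Real.abs_sin_le_one ν) hz
  have e : (Real.cos μ * (x1 + y1) + Real.sin μ * z1) - (Real.cos ν * (x2 + y2) + Real.sin ν * z2) - l
      = (Real.cos μ - Real.cos ν) * (x1 + y1) + (Real.cos ν - 1) * (x1 - x2) + (x1 - x2 - l)
        + Real.cos ν * (y1 - y2) + (Real.sin μ - Real.sin ν) * z1 + Real.sin ν * (z1 - z2) := by ring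
  have hCC : C ≤ C * C := by nlinarith
  have b1 : η * d * (C * C + C * ε) ≤ 2 * (C * C) * η * d := by
    have : C * ε ≤ C * C := by nlinarith
    have := mul_le_mul_of_nonneg_left this (show 0 ≤ η * d by positivity)
    linarith
  have b2 : C * ε * d ≤ C * C * ε * d := by gcongr
  have b3 : C * (η + δ) * d ≤ C * C * (η + δ) * d := by gcongr
  have b4 : 0 ≤ C * C * η * d := by positivity
  rw [e, abs_le]
  rw [abs_le] at t1 t2 t3 t4 t5 hl
  constructor <;> linarith

lemma est_0 {C η δ ε d μ ν x0 x1 x2 y1 y2 z1 z2 m : ℝ} (hC : 1 ≤ C) (hη : 0 < η) (hη1 : η ≤ 1)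
    (hδ : 0 < δ) (hε : 0 < ε) (hε1 : ε ≤ 1) (hμ : |μ| ≤ η) (hν : |ν| ≤ η) (hd : |μ - ν| ≤ d)
    (hx1 : |x1| ≤ C * C) (hy1 : |y1| ≤ C * ε) (hz1 : |z1| ≤ C * ε)
    (hx : |x1 - x2| ≤ C * C * d) (hy : |y1 - y2| ≤ C * ε * d) (hz : |z1 - z2| ≤ C * ε * d)
    (hx0 : |x1 - x0| ≤ C * C * η) (hm : |x0 - m| ≤ C * δ) :
    |(Real.cos μ * z1 - Real.sin μ * (x1 + y1)) - (Real.cos ν * z2 - Real.sin ν * (x2 + y2))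
      - (-m) * (μ - ν)|
      ≤ C ^ 2 * (6 * η + δ + 3 * ε) * d := by
  have hd0 : 0 ≤ d := (abs_nonneg _).trans hd
  have c1 : |Real.cos μ - Real.cos ν| ≤ η * d := (cos_lip η μ ν hμ hν).trans (by gcongr)
  have s1 : |Real.sin μ - Real.sin ν - (μ - ν)| ≤ η * d :=
    (sin_lip η μ ν hη1 hμ hν).trans (by gcongr)
  have s2 : |Real.sin ν| ≤ η := Real.abs_sin_le_abs.trans hν
  have t1 := abs_mul_le' s1 (show |x1 + y1| ≤ C * C + C * ε from (abs_add_le _ _).trans (by linarith))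
  have t2 := abs_mul_le' c1 hz1
  have t3 := abs_mul_le' (Real.abs_cos_le_one ν) hz
  have t4 := abs_mul_le' s2 (show |(x1 - x2) + (y1 - y2)| ≤ C * C * d + C * ε * d from
    (abs_add_le _ _).trans (by linarith))
  have t5 := abs_mul_le' hd hx0
  have t6 := abs_mul_le' hd hm
  have t7 := abs_mul_le' hd hy1
  have e : (Real.cos μ * z1 - Real.sin μ * (x1 + y1)) - (Real.cos ν * z2 - Real.sin ν * (x2 + y2))
      - (-m) * (μ - ν)
      = (Real.cos μ - Real.cos ν) * z1 + Real.cos ν * (z1 - z2)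
        - (Real.sin μ - Real.sin ν - (μ - ν)) * (x1 + y1)
        - Real.sin ν * ((x1 - x2) + (y1 - y2)) - (μ - ν) * (x1 - x0) - (μ - ν) * (x0 - m)
        - (μ - ν) * y1 := by ring
  have hCC : C ≤ C * C := by nlinarith
  have h0 : C * ε ≤ C * C := by nlinarith
  have b1 : η * d * (C * C + C * ε) ≤ 2 * (C * C) * η * d := by
    have := mul_le_mul_of_nonneg_left h0 (show 0 ≤ η * d by positivity)
    linarith
  have b2 : C * ε * d ≤ C * C * ε * d := by gcongr
  have b5 : d * (C * δ) ≤ d * (C * C * δ) := by gcongr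
  have b6 : η * d * (C * ε) ≤ 1 * d * (C * C * ε) := by gcongr
  have b4 : 0 ≤ C * C * η * d := by positivity
  rw [e, abs_le]
  rw [abs_le] at t1 t2 t3 t4 t5 t6 t7
  constructor <;> linarith

lemma abs_inner_le' {H : Type*} [NormedAddCommGroup H] [InnerProductSpace ℝ H] {x y : H} {A B : ℝ}
    (h : ‖x‖ ≤ A) (h' : ‖y‖ ≤ B) : |inner ℝ x y| ≤ A * B :=
  (abs_real_inner_le_norm x y).trans
    (mul_le_mul h h' (norm_nonneg _) ((norm_nonneg _).trans h))

lemma abs_mod {H : Type*} [NormedAddCommGroup H] [InnerProductSpace ℝ H]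
    (B : R3 ≃L[ℝ] R3) (m C : ℝ) (hm : 0 < m) (hC : 1 ≤ C) :
    ∃ ε > (0 : ℝ), ∃ η > (0 : ℝ), ∃ δ > (0 : ℝ), η ≤ 1 ∧
      ∀ (X₀ : R3) (a : Fin 3 → R3 → H) (b : R3 → H) (p q : H),
        (∀ k X, ‖X - X₀‖ ≤ η → ‖a k X‖ ≤ C) →
        (∀ X, ‖X - X₀‖ ≤ η → ‖b X‖ ≤ C) →
        (∀ k X Y, ‖X - X₀‖ ≤ η → ‖Y - X₀‖ ≤ η → ‖a k X - a k Y‖ ≤ C * ‖X - Y‖) →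
        (∀ X Y, ‖X - X₀‖ ≤ η → ‖Y - X₀‖ ≤ η → ‖b X - b Y‖ ≤ C * ‖X - Y‖) →
        (∀ k X Y, ‖X - X₀‖ ≤ η → ‖Y - X₀‖ ≤ η →
          |inner ℝ (a k X) (b X₀) - inner ℝ (a k Y) (b X₀) - B (X - Y) k|
            ≤ C * (η + δ) * ‖X - Y‖) →
        (∀ k, inner ℝ (a k X₀) (b X₀) = 0) →
        |inner ℝ (b X₀) (b X₀) - m| ≤ C * δ →
        ‖p - b X₀‖ ≤ ε → ‖q‖ ≤ ε →
        ∃! P : R3 × ℝ, |P.2| + ‖P.1 - X₀‖ ≤ η ∧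
          (∀ k, Real.cos P.2 * inner ℝ (a k P.1) p + Real.sin P.2 * inner ℝ (a k P.1) q = 0) ∧
          Real.cos P.2 * inner ℝ (b P.1) q - Real.sin P.2 * inner ℝ (b P.1) p = 0 := by
  have hm' : -m ≠ 0 := by linarith
  let A : (R3 × ℝ) ≃L[ℝ] (R3 × ℝ) :=
    B.prodCongr (ContinuousLinearEquiv.unitsEquivAut ℝ (Units.mk0 (-m) hm'))
  have hA : ∀ P, A P = (B P.1, (-m) * P.2) := by
    intro P
    simp [A, ContinuousLinearEquiv.prodCongr_apply, mul_comm]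
  set β : ℝ := ‖(A.symm : (R3 × ℝ) →L[ℝ] (R3 × ℝ))‖ + 1 with hβ
  have hβ1 : 1 ≤ β := by simp [hβ]
  set t : ℝ := 1 / (160 * β * C ^ 2) with ht
  have hC0 : 0 < C := by linarith
  have hβ0 : 0 < β := by linarith
  have ht0 : 0 < t := by positivity
  have hden : 1 ≤ β * C ^ 2 := by
    have : (1:ℝ) ≤ C ^ 2 := one_le_pow₀ hC
    nlinarith
  have htb : β * C ^ 2 * t = 1 / 160 := by rw [ht]; field_simp
  have ht1 : t ≤ 1 := by nlinarith
  set ε : ℝ := t / (16 * β * C) with hε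
  have hε0 : 0 < ε := by positivity
  have hεb : β * C * ε = t / 16 := by rw [hε]; field_simp
  have hβC : 1 ≤ β * C := by nlinarith
  have hεt : ε ≤ t := by nlinarith
  refine ⟨ε, hε0, t, ht0, t, ht0, ht1, ?_⟩
  intro X₀ a b p q ha hb hda hdb hB hz hbm hp hq
  set p' := p - b X₀ with hp'
  have hpe : p = b X₀ + p' := by simp [hp']
  let Φ : R3 × ℝ → R3 × ℝ := fun P =>
    (WithLp.toLp 2 (fun k => Real.cos P.2 * inner ℝ (a k P.1) p + Real.sin P.2 * inner ℝ (a k P.1) q),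
      Real.cos P.2 * inner ℝ (b P.1) q - Real.sin P.2 * inner ℝ (b P.1) p)
  have hX0 : ‖X₀ - X₀‖ ≤ t := by simp [ht0.le]
  have hb0 := hb X₀ hX0
  have key := fp_aux Φ A β (2 * (C ^ 2 * (6 * t + t + 3 * ε))) t X₀ ht0 ?_ hβ0.le ?_ ?_ ?_
  · convert key using 2 with P
    simp only [Φ]
    refine and_congr_right fun _ => ?_
    rw [Prod.ext_iff]
    refine and_congr_left fun _ => ?_
    constructor
    · intro h
      ext k
      simpa using h k
    · intro h k
      have := congrArg (fun z : R3 => z k) h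
      simpa using this
  · intro z
    refine ((A.symm : (R3 × ℝ) →L[ℝ] (R3 × ℝ)).le_opNorm z).trans ?_
    gcongr
    simp [hβ]
  · nlinarith
  · intro P P' hP hP'
    have h1 : ‖P.1 - X₀‖ ≤ t := by linarith [abs_nonneg P.2]
    have h2 : ‖P'.1 - X₀‖ ≤ t := by linarith [abs_nonneg P'.2]
    have h3 : |P.2| ≤ t := by linarith [norm_nonneg (P.1 - X₀)]
    have h4 : |P'.2| ≤ t := by linarith [norm_nonneg (P'.1 - X₀)]
    set d := ‖P - P'‖ with hd
    have h5 : ‖P.1 - P'.1‖ ≤ d := by simpa using norm_fst_le (P - P')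
    have h6 : |P.2 - P'.2| ≤ d := by simpa using norm_snd_le (P - P')
    have hd0 : 0 ≤ d := norm_nonneg _
    have inn : ∀ (x y z : H) (E : ℝ), ‖x - y‖ ≤ C * ‖P.1 - P'.1‖ → ‖z‖ ≤ E →
        |inner ℝ x z - inner ℝ y z| ≤ C * E * d := by
      intro x y z E hxy hz
      rw [← inner_sub_left]
      refine (abs_inner_le' (hxy.trans (mul_le_mul_of_nonneg_left h5 hC0.le)) hz).trans (le_of_eq ?_)
      ring
    have hk : ∀ k, |(Φ P - Φ P' - A (P - P')).1 k| ≤ C ^ 2 * (6 * t + t + 3 * ε) * d := by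
      intro k
      have e : (Φ P - Φ P' - A (P - P')).1 k
        = (Real.cos P.2 * (inner ℝ (a k P.1) (b X₀) + inner ℝ (a k P.1) p')
            + Real.sin P.2 * inner ℝ (a k P.1) q)
          - (Real.cos P'.2 * (inner ℝ (a k P'.1) (b X₀) + inner ℝ (a k P'.1) p')
            + Real.sin P'.2 * inner ℝ (a k P'.1) q) - B (P.1 - P'.1) k := by
        rw [hA]
        simp only [Φ, hpe, inner_add_right]
        simp
      rw [e]
      exact est_k hC ht0 ht1 ht0 hε0 (hεt.trans ht1) h3 h4 h6
        (abs_inner_le' (ha k _ h1) hb0) (abs_inner_le' (ha k _ h1) hp) (abs_inner_le' (ha k _ h1) hq)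
        (inn _ _ _ _ (hda k _ _ h1 h2) hb0) (inn _ _ _ _ (hda k _ _ h1 h2) hp)
        (inn _ _ _ _ (hda k _ _ h1 h2) hq)
        ((hB k _ _ h1 h2).trans (by gcongr))
    have h0 : |(Φ P - Φ P' - A (P - P')).2| ≤ C ^ 2 * (6 * t + t + 3 * ε) * d := by
      have e : (Φ P - Φ P' - A (P - P')).2
        = (Real.cos P.2 * inner ℝ (b P.1) q
            - Real.sin P.2 * (inner ℝ (b P.1) (b X₀) + inner ℝ (b P.1) p'))
          - (Real.cos P'.2 * inner ℝ (b P'.1) q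
            - Real.sin P'.2 * (inner ℝ (b P'.1) (b X₀) + inner ℝ (b P'.1) p'))
          - (-m) * (P.2 - P'.2) := by
        rw [hA]
        simp only [Φ, hpe, inner_add_right]
        simp
      rw [e]
      refine est_0 (x0 := inner ℝ (b X₀) (b X₀)) hC ht0 ht1 ht0 hε0 (hεt.trans ht1) h3 h4 h6
        (abs_inner_le' (hb _ h1) hb0) (abs_inner_le' (hb _ h1) hp) (abs_inner_le' (hb _ h1) hq)
        (inn _ _ _ _ (hdb _ _ h1 h2) hb0) (inn _ _ _ _ (hdb _ _ h1 h2) hp)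
        (inn _ _ _ _ (hdb _ _ h1 h2) hq) ?_ hbm
      rw [← inner_sub_left]
      refine (abs_inner_le' ((hdb _ _ h1 hX0).trans (mul_le_mul_of_nonneg_left h1 hC0.le)) hb0).trans
        (le_of_eq ?_)
      ring
    have hnn : 0 ≤ C ^ 2 * (6 * t + t + 3 * ε) * d := by positivity
    have := R3_norm_le _ _ hnn hk
    rw [Prod.norm_def]
    apply max_le
    · linarith
    · rw [Real.norm_eq_abs]; linarith
  · have hk : ∀ k, |(Φ (X₀, 0)).1 k| ≤ C * ε := by
      intro k
      have e : (Φ (X₀, 0)).1 k = inner ℝ (a k X₀) p' := by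
        simp [Φ, hpe, inner_add_right, hz]
      rw [e]
      exact abs_inner_le' (ha k _ hX0) hp
    have h0 : |(Φ (X₀, 0)).2| ≤ C * ε := by
      have e : (Φ (X₀, 0)).2 = inner ℝ (b X₀) q := by simp [Φ]
      rw [e]
      exact abs_inner_le' hb0 hq
    have hnn : 0 ≤ C * ε := by positivity
    have h1 := R3_norm_le _ _ hnn hk
    have : ‖Φ (X₀, 0)‖ ≤ 2 * (C * ε) := by
      rw [Prod.norm_def]
      apply max_le
      · linarith
      · rw [Real.norm_eq_abs]; linarith
    nlinarith [mul_le_mul_of_nonneg_left this hβ0.le]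

/-- exponential envelope -/
def Ev (x : R3) : ℝ := Real.exp (-‖x‖)

lemma Ev_pos (x : R3) : 0 < Ev x := Real.exp_pos _

lemma Ev_le_one (x : R3) : Ev x ≤ 1 := by
  unfold Ev; exact Real.exp_le_one_iff.2 (by simp)

lemma Ev_cont : Continuous Ev := by unfold Ev; fun_prop

lemma Ev_shift (y y0 : R3) (h : ‖y - y0‖ ≤ 1) : Ev y ≤ 3 * Ev y0 := by
  unfold Ev
  have h1 : ‖y0‖ ≤ ‖y‖ + 1 := by
    have := norm_sub_norm_le y0 y
    rw [norm_sub_rev] at this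
    linarith
  calc Real.exp (-‖y‖) ≤ Real.exp (1 + -‖y0‖) := Real.exp_le_exp.2 (by linarith)
    _ = Real.exp 1 * Real.exp (-‖y0‖) := Real.exp_add _ _
    _ ≤ _ := by gcongr; exact Real.exp_one_lt_three.le

lemma Ev_int : Integrable Ev := by
  have h : Integrable (fun x : R3 => (1 + ‖x‖) ^ (-(4:ℝ))) :=
    integrable_one_add_norm (by simp; norm_num)
  refine (h.const_mul 200).mono' Ev_cont.aestronglyMeasurable (Filter.Eventually.of_forall fun x => ?_)
  rw [Real.norm_of_nonneg (Ev_pos x).le]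
  unfold Ev
  have h0 : 0 < 1 + ‖x‖ := by positivity
  rw [Real.rpow_neg h0.le, Real.exp_neg, ← div_eq_mul_inv, inv_eq_one_div,
    div_le_div_iff₀ (Real.exp_pos _) (by positivity)]
  have h1 := Real.pow_div_factorial_le_exp (1 + ‖x‖) h0.le 4
  rw [Real.exp_add] at h1
  have h2 := Real.exp_one_lt_three
  have h3 := Real.exp_pos ‖x‖
  have h4 : (1 + ‖x‖) ^ (4:ℝ) = (1 + ‖x‖) ^ 4 := by norm_cast
  rw [h4]
  norm_num [Nat.factorial] at h1
  nlinarith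

lemma Ev_int_sq : Integrable (fun x => Ev x ^ 2) := by
  refine Ev_int.mono' (Ev_cont.pow 2).aestronglyMeasurable (Filter.Eventually.of_forall fun x => ?_)
  rw [Real.norm_of_nonneg (by positivity)]
  nlinarith [Ev_pos x, Ev_le_one x]

lemma memLp_of_Ev {f : R3 → ℝ} (hf : Continuous f) (c : ℝ) (X : R3)
    (h : ∀ x, |f x| ≤ c * Ev (x - X)) : MemLp f 2 volume := by
  have h1 : MemLp (fun x => Ev (x - X)) 2 volume :=
    (memLp_two_iff_integrable_sq (Ev_cont.comp (continuous_sub_right X)).aestronglyMeasurable).2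
      (Ev_int_sq.comp_sub_right X)
  refine h1.of_le_mul (c := c) hf.aestronglyMeasurable (Filter.Eventually.of_forall fun x => ?_)
  rw [Real.norm_eq_abs, Real.norm_of_nonneg (Ev_pos _).le]
  exact h x

lemma inner_toLp {f g : R3 → ℝ} (hf : MemLp f 2 volume) (hg : MemLp g 2 volume) :
    inner ℝ (hf.toLp f) (hg.toLp g) = ∫ x, f x * g x := by
  rw [L2.inner_def]
  apply integral_congr_ae
  filter_upwards [hf.coeFn_toLp, hg.coeFn_toLp] with x h1 h2
  rw [h1, h2]
  simp [mul_comm]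

lemma norm_toLp_sq {f : R3 → ℝ} (hf : MemLp f 2 volume) :
    ‖hf.toLp f‖ ^ 2 = ∫ x, f x ^ 2 := by
  rw [← real_inner_self_eq_norm_sq, inner_toLp hf hf]
  simp [sq]

lemma norm_toLp_le {f : R3 → ℝ} (hf : MemLp f 2 volume) (c : ℝ) (hc : 0 ≤ c) (X : R3)
    (h : ∀ x, |f x| ≤ c * Ev (x - X)) :
    ‖hf.toLp f‖ ≤ c * Real.sqrt (∫ x, Ev x ^ 2) := by
  have h0 : 0 ≤ ∫ x, Ev x ^ 2 := integral_nonneg fun x => by positivity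
  refine le_of_sq_le_sq ?_ (by positivity)
  rw [norm_toLp_sq, mul_pow, Real.sq_sqrt h0, ← integral_const_mul,
    ← integral_sub_right_eq_self (fun x => c ^ 2 * Ev x ^ 2) X]
  refine integral_mono (hf.integrable_sq) ((Ev_int_sq.const_mul _).comp_sub_right X) fun x => ?_
  show f x ^ 2 ≤ c ^ 2 * Ev (x - X) ^ 2
  rw [← mul_pow, ← sq_abs]
  exact pow_le_pow_left₀ (abs_nonneg _) (h x) 2

lemma envelope (Q : R3 → ℝ) (hQC2 : ContDiff ℝ 2 Q) (hQpos : ∀ x : R3, 0 < Q x) 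
    (a C₀ : ℝ) (ha : 0 < a) (hC₀ : 0 < C₀)
    (hdecay : ∀ x : R3, 1 < ‖x‖ →
      |Q x - (a / ‖x‖) * Real.exp (-‖x‖)| ≤ C₀ * Real.exp (-‖x‖) / ‖x‖ ^ ((3 : ℝ) / 2) ∧
      ‖fderiv ℝ Q x‖ + ‖fderiv ℝ (fderiv ℝ Q) x‖ ≤ C₀ * Real.exp (-‖x‖) / ‖x‖) :
    ∃ M : ℝ, 1 ≤ M ∧ ∀ x, |Q x| ≤ M * Ev x ∧ ‖fderiv ℝ Q x‖ ≤ M * Ev x ∧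
      ‖fderiv ℝ (fderiv ℝ Q) x‖ ≤ M * Ev x := by
  have hD : ContDiff ℝ 1 (fderiv ℝ Q) := hQC2.fderiv_right (by norm_num)
  have hD2 : Continuous (fderiv ℝ (fderiv ℝ Q)) := hD.continuous_fderiv (by norm_num)
  have hcont : Continuous (fun x => |Q x| + ‖fderiv ℝ Q x‖ + ‖fderiv ℝ (fderiv ℝ Q) x‖) := by
    have h3 : Continuous (fun x => ‖fderiv ℝ (fderiv ℝ Q) x‖) :=
      (continuous_norm (E := R3 →L[ℝ] R3 →L[ℝ] ℝ)).comp hD2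
    exact (hQC2.continuous.abs.add hD.continuous.norm).add h3
  obtain ⟨M1, hM1⟩ := (isCompact_closedBall (0 : R3) 1).exists_bound_of_continuousOn hcont.continuousOn
  set S := 3 * |M1| + a + C₀ + 1 with hS
  refine ⟨S, by have := abs_nonneg M1; linarith, fun x => ?_⟩
  have hE := Ev_pos x
  have hM0 := abs_nonneg M1
  have hn1 := norm_nonneg (fderiv ℝ Q x)
  have hn2 := norm_nonneg (fderiv ℝ (fderiv ℝ Q) x)
  have hn0 := abs_nonneg (Q x)
  by_cases hx : ‖x‖ ≤ 1
  · have h1 := hM1 x (by simpa using hx)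
    rw [Real.norm_of_nonneg (by positivity)] at h1
    have h2 := Ev_shift 0 x (by simpa using hx)
    have h3 : Ev 0 = 1 := by simp [Ev]
    rw [h3] at h2
    have h4 : |M1| ≤ S * Ev x := by
      have : |M1| * 1 ≤ |M1| * (3 * Ev x) := by gcongr
      have h5 : (3 * |M1|) * Ev x ≤ S * Ev x := by
        gcongr
        linarith
      linarith
    have := le_abs_self M1
    refine ⟨?_, ?_, ?_⟩ <;> linarith
  · push Not at hx
    obtain ⟨h1, h2⟩ := hdecay x hx
    have hEe : Real.exp (-‖x‖) = Ev x := rfl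
    rw [hEe] at h1 h2
    have h3 : C₀ * Ev x / ‖x‖ ≤ C₀ * Ev x := div_le_self (by positivity) hx.le
    have h4 : C₀ * Ev x / ‖x‖ ^ ((3 : ℝ) / 2) ≤ C₀ * Ev x :=
      div_le_self (by positivity) (Real.one_le_rpow hx.le (by norm_num))
    have h5 : a / ‖x‖ * Ev x ≤ a * Ev x := by
      gcongr; exact div_le_self ha.le hx.le
    have h6 : |Q x| ≤ a * Ev x + C₀ * Ev x := by
      rw [abs_of_pos (hQpos x)]
      linarith [(abs_le.1 h1).2]
    have h7 : S * Ev x = 3 * |M1| * Ev x + a * Ev x + C₀ * Ev x + Ev x := by rw [hS]; ring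
    have h8 : 0 ≤ |M1| * Ev x := by positivity
    have h9 : 0 ≤ a * Ev x := by positivity
    refine ⟨?_, ?_, ?_⟩ <;> linarith

section
variable {Q : R3 → ℝ} {M : ℝ} 

lemma ptw (hQC2 : ContDiff ℝ 2 Q) (hM1 : 1 ≤ M)
    (hM : ∀ x, |Q x| ≤ M * Ev x ∧ ‖fderiv ℝ Q x‖ ≤ M * Ev x ∧
      ‖fderiv ℝ (fderiv ℝ Q) x‖ ≤ M * Ev x)
    {η : ℝ} (hη1 : η ≤ 1) {X₀ X Y : R3} (hX : ‖X - X₀‖ ≤ η) (hY : ‖Y - X₀‖ ≤ η) (x : R3) :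
    |Q (x - X)| ≤ 3 * M * Ev (x - X₀) ∧ ‖fderiv ℝ Q (x - X)‖ ≤ 3 * M * Ev (x - X₀) ∧
    |Q (x - X) - Q (x - Y)| ≤ 3 * M * Ev (x - X₀) * ‖X - Y‖ ∧
    ‖fderiv ℝ Q (x - X) - fderiv ℝ Q (x - Y)‖ ≤ 3 * M * Ev (x - X₀) * ‖X - Y‖ ∧
    |Q (x - X) - Q (x - Y) + fderiv ℝ Q (x - X₀) (X - Y)|
      ≤ (3 * M * Ev (x - X₀) * η) * ‖X - Y‖ := by
  have hQd : Differentiable ℝ Q := hQC2.differentiable (by norm_num)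
  have hD : Differentiable ℝ (fderiv ℝ Q) :=
    (hQC2.fderiv_right (m := 1) (by norm_num)).differentiable (by norm_num)
  have hM0 : 0 ≤ M := by linarith
  set s := Metric.closedBall (x - X₀) η with hs
  have hmem : ∀ Z : R3, ‖Z - X₀‖ ≤ η → x - Z ∈ s := by
    intro Z hZ
    rw [hs, mem_closedBall_iff_norm]
    rwa [show x - Z - (x - X₀) = -(Z - X₀) by abel, norm_neg]
  have hη0 : 0 ≤ η := (norm_nonneg _).trans hX
  have hsE : ∀ y ∈ s, M * Ev y ≤ 3 * M * Ev (x - X₀) := by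
    intro y hy
    have := Ev_shift y (x - X₀) ((mem_closedBall_iff_norm.1 hy).trans hη1)
    calc _ ≤ M * (3 * Ev (x - X₀)) := by gcongr
      _ = _ := by ring
  have hconv : Convex ℝ s := convex_closedBall _ _
  have hx0 : x - X₀ ∈ s := hmem _ (by simpa using hη0)
  have hXY : x - X - (x - Y) = -(X - Y) := by abel
  refine ⟨(hM _).1.trans (hsE _ (hmem X hX)), (hM _).2.1.trans (hsE _ (hmem X hX)), ?_, ?_, ?_⟩
  · have := hconv.norm_image_sub_le_of_norm_fderiv_le (𝕜 := ℝ) (f := Q) (fun y _ => hQd y)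
      (fun y hy => (hM y).2.1.trans (hsE y hy)) (hmem Y hY) (hmem X hX)
    rwa [hXY, norm_neg] at this
  · have := hconv.norm_image_sub_le_of_norm_fderiv_le (𝕜 := ℝ) (f := fderiv ℝ Q) (fun y _ => hD y)
      (fun y hy => (hM y).2.2.trans (hsE y hy)) (hmem Y hY) (hmem X hX)
    rwa [hXY, norm_neg] at this
  · have := hconv.norm_image_sub_le_of_norm_fderiv_le' (𝕜 := ℝ) (f := Q) (φ := fderiv ℝ Q (x - X₀))
      (C := 3 * M * Ev (x - X₀) * η) (fun y _ => hQd y)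
      (fun y hy => by
        have h := hconv.norm_image_sub_le_of_norm_fderiv_le (𝕜 := ℝ) (f := fderiv ℝ Q)
          (fun y _ => hD y) (fun y hy => (hM y).2.2.trans (hsE y hy)) hx0 hy
        refine h.trans ?_
        have := Ev_pos (x - X₀)
        gcongr
        exact mem_closedBall_iff_norm.1 hy) (hmem Y hY) (hmem X hX)
    rw [hXY, norm_neg, map_neg, sub_neg_eq_add] at this
    exact this

end

lemma gram (Q : R3 → ℝ) (M : ℝ) (hQC2 : ContDiff ℝ 2 Q) (hQpos : ∀ x : R3, 0 < Q x)
    (hM : ∀ x, |Q x| ≤ M * Ev x ∧ ‖fderiv ℝ Q x‖ ≤ M * Ev x ∧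
      ‖fderiv ℝ (fderiv ℝ Q) x‖ ≤ M * Ev x) :
    ∃ B : R3 ≃L[ℝ] R3, ∀ z k,
      B z k = ∫ x, fderiv ℝ Q x (EuclideanSpace.single k 1) * fderiv ℝ Q x z := by
  have hQd : Differentiable ℝ Q := hQC2.differentiable (by norm_num)
  have hDc : Continuous (fderiv ℝ Q) := hQC2.continuous_fderiv (by norm_num)
  have hc : ∀ z, Continuous fun x => fderiv ℝ Q x z := fun z => hDc.clm_apply continuous_const
  have hmem : ∀ z, MemLp (fun x => fderiv ℝ Q x z) 2 volume := by
    intro z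
    refine memLp_of_Ev (hc z) (M * ‖z‖) 0 fun x => ?_
    rw [sub_zero]
    calc |fderiv ℝ Q x z| ≤ ‖fderiv ℝ Q x‖ * ‖z‖ := (fderiv ℝ Q x).le_opNorm z
      _ ≤ (M * Ev x) * ‖z‖ := by gcongr; exact (hM x).2.1
      _ = _ := by ring
  have hint : ∀ z w, Integrable (fun x => fderiv ℝ Q x z * fderiv ℝ Q x w) := fun z w =>
    (hmem z).integrable_mul (hmem w)
  let B₀ : R3 →ₗ[ℝ] R3 :=
    { toFun := fun z => WithLp.toLp 2 fun k =>
        ∫ x, fderiv ℝ Q x (EuclideanSpace.single k 1) * fderiv ℝ Q x z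
      map_add' := by
        intro z w
        ext k
        simp only [map_add, mul_add, PiLp.add_apply]
        exact integral_add (hint _ _) (hint _ _)
      map_smul' := by
        intro c z
        ext k
        simp only [map_smul, smul_eq_mul, PiLp.smul_apply, RingHom.id_apply]
        rw [← integral_const_mul]
        congr 1; ext x; ring }
  have hB₀ : ∀ z k, B₀ z k = ∫ x, fderiv ℝ Q x (EuclideanSpace.single k 1) * fderiv ℝ Q x z :=
    fun z k => rfl
  have hinj : Function.Injective B₀ := by
    rw [← LinearMap.ker_eq_bot, LinearMap.ker_eq_bot']
    intro z hz
    have hsum : ∫ x, fderiv ℝ Q x z * fderiv ℝ Q x z = 0 := by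
      have e : ∀ x, fderiv ℝ Q x z * fderiv ℝ Q x z
          = ∑ k, z k * (fderiv ℝ Q x (EuclideanSpace.single k 1) * fderiv ℝ Q x z) := by
        intro x
        have hz' : z = ∑ k, z k • (EuclideanSpace.single k (1:ℝ) : R3) := by
          ext i
          simp [Finset.sum_apply, Pi.single_apply]
        have : fderiv ℝ Q x z = ∑ k, z k * fderiv ℝ Q x (EuclideanSpace.single k 1) := by
          conv_lhs => rw [hz']
          simp
        conv_lhs => rw [this]
        rw [this, Finset.sum_mul]
        refine Finset.sum_congr rfl fun k _ => by ring
      simp_rw [e]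
      rw [integral_finsetSum _ fun k _ => (hint _ _).const_mul _]
      refine Finset.sum_eq_zero fun k _ => ?_
      rw [integral_const_mul, ← hB₀, hz]
      simp
    have hzero : ∀ x, fderiv ℝ Q x z = 0 := by
      rw [integral_eq_zero_iff_of_nonneg (fun x => mul_self_nonneg _) (hint _ _)] at hsum
      have := (Continuous.ae_eq_iff_eq volume ((hc z).mul (hc z)) continuous_const).1 hsum
      intro x
      exact mul_self_eq_zero.1 (congrFun this x)
    by_contra hz0
    have hconst : ∀ t : ℝ, Q (t • z) = Q 0 := by
      have hd : ∀ t : ℝ, HasDerivAt (fun t : ℝ => Q (t • z)) 0 t := by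
        intro t
        have h1 : HasDerivAt (fun t : ℝ => t • z) z t := by
          simpa using (hasDerivAt_id t).smul_const z
        have := (hQd (t • z)).hasFDerivAt.comp_hasDerivAt t h1
        rw [hzero] at this
        exact this
      intro t
      have := is_const_of_deriv_eq_zero (f := fun t : ℝ => Q (t • z))
        (fun t => (hd t).differentiableAt) (fun t => (hd t).deriv) t 0
      simpa using this
    have hlim : Filter.Tendsto (fun t : ℝ => M * Ev (t • z)) Filter.atTop (nhds (M * 0)) := by
      refine Filter.Tendsto.const_mul M ?_
      unfold Ev
      refine Real.tendsto_exp_neg_atTop_nhds_zero.comp ?_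
      simp only [norm_smul]
      exact Filter.Tendsto.atTop_mul_const (norm_pos_iff.2 hz0) tendsto_norm_atTop_atTop
    have : Q 0 ≤ M * 0 := ge_of_tendsto' hlim fun t => by
      rw [← hconst t]; exact (le_abs_self _).trans (hM _).1
    linarith [hQpos 0]
  refine ⟨(LinearEquiv.ofInjectiveEndo B₀ hinj).toContinuousLinearEquiv, fun z k => ?_⟩
  exact hB₀ z k

/-- the modulated profile -/
def bf (Q Ψ : R3 → ℝ) (X x : R3) : ℝ := Q (x - X) * Ψ x

/-- its partial derivatives -/
def af (Q Ψ : R3 → ℝ) (k : Fin 3) (X x : R3) : ℝ :=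
  fderiv ℝ (fun y => Q (y - X) * Ψ y) x (EuclideanSpace.single k 1)

lemma af_eq {Q Ψ : R3 → ℝ} (hQ : Differentiable ℝ Q) (hΨ : Differentiable ℝ Ψ) (k : Fin 3)
    (X x : R3) :
    af Q Ψ k X x = Q (x - X) * fderiv ℝ Ψ x (EuclideanSpace.single k 1)
      + Ψ x * fderiv ℝ Q (x - X) (EuclideanSpace.single k 1) := by
  unfold af
  have h1 : HasFDerivAt (fun y => Q (y - X)) (fderiv ℝ Q (x - X)) x := by
    exact (hasFDerivAt_comp_sub X).2 (hQ (x - X)).hasFDerivAt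
  have := h1.mul (hΨ x).hasFDerivAt
  have h2 := this.fderiv
  erw [h2]
  simp

lemma ek_norm (k : Fin 3) : ‖(EuclideanSpace.single k (1:ℝ) : R3)‖ = 1 := by simp

/-- all pointwise facts -/
lemma ptw2 {Q Ψ : R3 → ℝ} {M N : ℝ} (hQC2 : ContDiff ℝ 2 Q) (hM1 : 1 ≤ M)
    (hM : ∀ x, |Q x| ≤ M * Ev x ∧ ‖fderiv ℝ Q x‖ ≤ M * Ev x ∧
      ‖fderiv ℝ (fderiv ℝ Q) x‖ ≤ M * Ev x)
    (hΨd : Differentiable ℝ Ψ) (hΨ01 : ∀ x, |Ψ x| ≤ 1) (hN : ∀ x, ‖fderiv ℝ Ψ x‖ + 1 ≤ N)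
    {η : ℝ} (hη1 : η ≤ 1) {X₀ X Y : R3} (hX : ‖X - X₀‖ ≤ η) (hY : ‖Y - X₀‖ ≤ η) (k : Fin 3)
    (x : R3) :
    |bf Q Ψ X x| ≤ 3 * M * N * Ev (x - X₀) ∧
    |af Q Ψ k X x| ≤ 3 * M * N * Ev (x - X₀) ∧
    |bf Q Ψ X x - bf Q Ψ Y x| ≤ 3 * M * N * ‖X - Y‖ * Ev (x - X₀) ∧
    |af Q Ψ k X x - af Q Ψ k Y x| ≤ 3 * M * N * ‖X - Y‖ * Ev (x - X₀) := by
  have hQd : Differentiable ℝ Q := hQC2.differentiable (by norm_num)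
  obtain ⟨h1, h2, h3, h4, -⟩ := ptw hQC2 hM1 hM hη1 hX hY x
  have hE := Ev_pos (x - X₀)
  have hM0 : 0 < M := by linarith
  have hN1 : 1 ≤ N := by linarith [hN x, norm_nonneg (fderiv ℝ Ψ x)]
  have hap : ∀ T : R3 →L[ℝ] ℝ, |T (EuclideanSpace.single k 1)| ≤ ‖T‖ := fun T => by
    simpa using T.le_opNorm (EuclideanSpace.single k 1)
  have hψ := hap (fderiv ℝ Ψ x)
  have hN' := hN x
  have hψ' : |fderiv ℝ Ψ x (EuclideanSpace.single k 1)| ≤ N - 1 := by linarith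
  have hXY := norm_nonneg (X - Y)
  unfold bf
  rw [af_eq hQd hΨd, af_eq hQd hΨd]
  refine ⟨?_, ?_, ?_, ?_⟩
  · refine (abs_mul_le' h1 (hΨ01 x)).trans ?_
    have : 3 * M * Ev (x - X₀) * 1 ≤ 3 * M * Ev (x - X₀) * N := by gcongr
    linarith
  · have t1 := abs_mul_le' h1 hψ'
    have t2 := abs_mul_le' (hΨ01 x) ((hap _).trans h2)
    refine (abs_add_le _ _).trans ?_
    linarith
  · rw [← sub_mul]
    refine (abs_mul_le' h3 (hΨ01 x)).trans ?_
    have : 3 * M * Ev (x - X₀) * ‖X - Y‖ * 1 ≤ 3 * M * Ev (x - X₀) * ‖X - Y‖ * N := by gcongr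
    linarith
  · have t1 := abs_mul_le' h3 hψ'
    have t2 := abs_mul_le' (hΨ01 x) ((hap _).trans h4)
    rw [sub_apply] at t2
    have e : ∀ q1 q2 d w d1 d2 : ℝ, q1 * d + w * d1 - (q2 * d + w * d2)
        = (q1 - q2) * d + w * (d1 - d2) := by intros; ring
    rw [e]
    refine (abs_add_le _ _).trans ?_
    linarith

section
variable {Q Ψ : R3 → ℝ} {M N : ℝ}

lemma bf_cont (hQC2 : ContDiff ℝ 2 Q) (hΨC : ContDiff ℝ 1 Ψ) (X : R3) : Continuous (bf Q Ψ X) := by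
  unfold bf
  exact (hQC2.continuous.comp (continuous_sub_right X)).mul hΨC.continuous

lemma af_cont (hQC2 : ContDiff ℝ 2 Q) (hΨC : ContDiff ℝ 1 Ψ) (k : Fin 3) (X : R3) :
    Continuous (af Q Ψ k X) := by
  have e : af Q Ψ k X = fun x => Q (x - X) * fderiv ℝ Ψ x (EuclideanSpace.single k 1)
      + Ψ x * fderiv ℝ Q (x - X) (EuclideanSpace.single k 1) := by
    funext x
    exact af_eq (hQC2.differentiable (by norm_num)) (hΨC.differentiable (by norm_num)) k X x
  rw [e]
  have h1 : Continuous fun x => fderiv ℝ Ψ x (EuclideanSpace.single k 1) :=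
    (hΨC.continuous_fderiv (by norm_num)).clm_apply continuous_const
  have h2 : Continuous fun x => fderiv ℝ Q x (EuclideanSpace.single k 1) :=
    (hQC2.continuous_fderiv (by norm_num)).clm_apply continuous_const
  exact ((hQC2.continuous.comp (continuous_sub_right X)).mul h1).add
    (hΨC.continuous.mul (h2.comp (continuous_sub_right X)))

lemma bf_memLp (hQC2 : ContDiff ℝ 2 Q) (hM1 : 1 ≤ M)
    (hM : ∀ x, |Q x| ≤ M * Ev x ∧ ‖fderiv ℝ Q x‖ ≤ M * Ev x ∧
      ‖fderiv ℝ (fderiv ℝ Q) x‖ ≤ M * Ev x)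
    (hΨC : ContDiff ℝ 1 Ψ) (hΨ01 : ∀ x, |Ψ x| ≤ 1) (hN : ∀ x, ‖fderiv ℝ Ψ x‖ + 1 ≤ N) (X : R3) :
    MemLp (bf Q Ψ X) 2 volume :=
  memLp_of_Ev (bf_cont hQC2 hΨC X) (3 * M * N) X fun x =>
    (ptw2 hQC2 hM1 hM (hΨC.differentiable (by norm_num)) hΨ01 hN le_rfl (X₀ := X) (X := X) (Y := X)
      (by simp) (by simp) 0 x).1

lemma af_memLp (hQC2 : ContDiff ℝ 2 Q) (hM1 : 1 ≤ M)
    (hM : ∀ x, |Q x| ≤ M * Ev x ∧ ‖fderiv ℝ Q x‖ ≤ M * Ev x ∧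
      ‖fderiv ℝ (fderiv ℝ Q) x‖ ≤ M * Ev x)
    (hΨC : ContDiff ℝ 1 Ψ) (hΨ01 : ∀ x, |Ψ x| ≤ 1) (hN : ∀ x, ‖fderiv ℝ Ψ x‖ + 1 ≤ N) (k : Fin 3)
    (X : R3) :
    MemLp (af Q Ψ k X) 2 volume :=
  memLp_of_Ev (af_cont hQC2 hΨC k X) (3 * M * N) X fun x =>
    (ptw2 hQC2 hM1 hM (hΨC.differentiable (by norm_num)) hΨ01 hN le_rfl (X₀ := X) (X := X) (Y := X)
      (by simp) (by simp) k x).2.1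

lemma ibp (hQC2 : ContDiff ℝ 2 Q) (hM1 : 1 ≤ M)
    (hM : ∀ x, |Q x| ≤ M * Ev x ∧ ‖fderiv ℝ Q x‖ ≤ M * Ev x ∧
      ‖fderiv ℝ (fderiv ℝ Q) x‖ ≤ M * Ev x)
    (hΨC : ContDiff ℝ 1 Ψ) (hΨ01 : ∀ x, |Ψ x| ≤ 1) (hN : ∀ x, ‖fderiv ℝ Ψ x‖ + 1 ≤ N) (k : Fin 3)
    (X Y : R3) :
    ∫ x, bf Q Ψ X x * af Q Ψ k Y x = - ∫ x, af Q Ψ k X x * bf Q Ψ Y x := by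
  have hb := bf_memLp hQC2 hM1 hM hΨC hΨ01 hN
  have ha := af_memLp hQC2 hM1 hM hΨC hΨ01 hN k
  have hd : ∀ X, Differentiable ℝ (bf Q Ψ X) := by
    intro X
    unfold bf
    have h1 : Differentiable ℝ fun y => Q (y - X) :=
      (hQC2.differentiable (by norm_num)).comp (differentiable_id.sub_const X)
    exact h1.mul (hΨC.differentiable (by norm_num))
  exact integral_mul_fderiv_eq_neg_fderiv_mul_of_integrable
    ((ha X).integrable_mul (hb Y)) ((hb X).integrable_mul (ha Y)) ((hb X).integrable_mul (hb Y))
    (fun x _ => hd X x) (fun x _ => hd Y x)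

lemma ptw3 (hQC2 : ContDiff ℝ 2 Q) (hM1 : 1 ≤ M)
    (hM : ∀ x, |Q x| ≤ M * Ev x ∧ ‖fderiv ℝ Q x‖ ≤ M * Ev x ∧
      ‖fderiv ℝ (fderiv ℝ Q) x‖ ≤ M * Ev x)
    (hΨd : Differentiable ℝ Ψ) (hΨ01 : ∀ x, |Ψ x| ≤ 1) (hN : ∀ x, ‖fderiv ℝ Ψ x‖ + 1 ≤ N)
    {η δ : ℝ} (hη1 : η ≤ 1) (hδ0 : 0 < δ) {X₀ X Y : R3} (hX : ‖X - X₀‖ ≤ η) (hY : ‖Y - X₀‖ ≤ η)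
    (hδ : ∀ x, (Ψ x = 1 ∧ fderiv ℝ Ψ x = 0) ∨ Ev (x - X₀) ≤ δ)
    (k : Fin 3) (x : R3) :
    |bf Q Ψ Y x * af Q Ψ k X₀ x - bf Q Ψ X x * af Q Ψ k X₀ x -
      fderiv ℝ Q (x - X₀) (EuclideanSpace.single k 1) * fderiv ℝ Q (x - X₀) (X - Y)|
      ≤ (9 * M ^ 2 * N * ‖X - Y‖) * (η * Ev (x - X₀) ^ 2 + δ * Ev (x - X₀)) := by
  have hQd : Differentiable ℝ Q := hQC2.differentiable (by norm_num)
  have hη0 : 0 ≤ η := (norm_nonneg _).trans hX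
  have hM0 : 0 < M := by linarith
  have hN1 : 1 ≤ N := by linarith [hN x, norm_nonneg (fderiv ℝ Ψ x)]
  obtain ⟨-, -, -, -, h5⟩ := ptw hQC2 hM1 hM hη1 hX hY x
  obtain ⟨-, h6, -, -⟩ := ptw2 (X₀ := X₀) (X := X₀) (Y := Y) hQC2 hM1 hM hΨd hΨ01 hN hη1 (by simpa using hη0) hY k x
  set E := Ev (x - X₀) with hEdef
  have hE : 0 < E := Ev_pos _
  set D := fderiv ℝ Q (x - X₀) with hDdef
  have hD : ‖D‖ ≤ M * E := (hM _).2.1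
  have hDk : |D (EuclideanSpace.single k 1)| ≤ M * E := by
    have := D.le_opNorm (EuclideanSpace.single k 1)
    simp only [ek_norm, mul_one, Real.norm_eq_abs] at this
    exact this.trans hD
  have hDz : |D (X - Y)| ≤ M * E * ‖X - Y‖ := (D.le_opNorm _).trans (by gcongr)
  set A := af Q Ψ k X₀ x with hAdef
  have hz := norm_nonneg (X - Y)
  have e : bf Q Ψ Y x * A - bf Q Ψ X x * A - D (EuclideanSpace.single k 1) * D (X - Y)
      = -((Q (x - X) - Q (x - Y) + D (X - Y)) * (Ψ x * A))
        + D (X - Y) * (Ψ x * A - D (EuclideanSpace.single k 1)) := by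
    unfold bf; ring
  have hΨA := abs_mul_le' (hΨ01 x) h6
  have t1 := abs_mul_le' h5 hΨA
  have t2 : |D (X - Y) * (Ψ x * A - D (EuclideanSpace.single k 1))|
      ≤ 4 * M ^ 2 * N * ‖X - Y‖ * (δ * E) := by
    rcases hδ x with ⟨h1, h2⟩ | h
    · have : Ψ x * A - D (EuclideanSpace.single k 1) = 0 := by
        rw [hAdef, af_eq hQd hΨd, h1, h2]
        simp [hDdef]
      rw [this, mul_zero, abs_zero]
      positivity
    · have h3 : |Ψ x * A - D (EuclideanSpace.single k 1)| ≤ 4 * M * N * E := by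
        refine (abs_sub _ _).trans ?_
        have : M * E * 1 ≤ M * E * N := by gcongr
        linarith
      refine (abs_mul_le' hDz h3).trans ?_
      have : (4 * M ^ 2 * N * ‖X - Y‖ * E) * E ≤ (4 * M ^ 2 * N * ‖X - Y‖ * E) * δ := by gcongr
      linarith
  rw [e]
  refine (abs_add_le _ _).trans ?_
  rw [abs_neg]
  have : 0 ≤ M ^ 2 * N * ‖X - Y‖ * (δ * E) := by positivity
  linarith

lemma main_est (hQC2 : ContDiff ℝ 2 Q) (hM1 : 1 ≤ M)
    (hM : ∀ x, |Q x| ≤ M * Ev x ∧ ‖fderiv ℝ Q x‖ ≤ M * Ev x ∧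
      ‖fderiv ℝ (fderiv ℝ Q) x‖ ≤ M * Ev x)
    (hΨC : ContDiff ℝ 1 Ψ) (hΨ01 : ∀ x, |Ψ x| ≤ 1) (hN : ∀ x, ‖fderiv ℝ Ψ x‖ + 1 ≤ N)
    {η δ : ℝ} (hη1 : η ≤ 1) (hδ0 : 0 < δ) {X₀ X Y : R3} (hX : ‖X - X₀‖ ≤ η) (hY : ‖Y - X₀‖ ≤ η)
    (hδ : ∀ x, (Ψ x = 1 ∧ fderiv ℝ Ψ x = 0) ∨ Ev (x - X₀) ≤ δ)
    (k : Fin 3) :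
    |(∫ x, af Q Ψ k X x * bf Q Ψ X₀ x) - (∫ x, af Q Ψ k Y x * bf Q Ψ X₀ x) -
      ∫ x, fderiv ℝ Q x (EuclideanSpace.single k 1) * fderiv ℝ Q x (X - Y)|
      ≤ (9 * M ^ 2 * N * ‖X - Y‖) * (η * (∫ x, Ev x ^ 2) + δ * ∫ x, Ev x) := by
  have hΨd : Differentiable ℝ Ψ := hΨC.differentiable (by norm_num)
  have hb := bf_memLp hQC2 hM1 hM hΨC hΨ01 hN
  have ha := af_memLp hQC2 hM1 hM hΨC hΨ01 hN k
  have i1 := ibp hQC2 hM1 hM hΨC hΨ01 hN k X X₀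
  have i2 := ibp hQC2 hM1 hM hΨC hΨ01 hN k Y X₀
  have hDm : ∀ z, MemLp (fun x => fderiv ℝ Q (x - X₀) z) 2 volume := by
    intro z
    refine memLp_of_Ev (((hQC2.continuous_fderiv (by norm_num)).clm_apply continuous_const).comp
      (continuous_sub_right X₀)) (M * ‖z‖) X₀ fun x => ?_
    calc |fderiv ℝ Q (x - X₀) z| ≤ ‖fderiv ℝ Q (x - X₀)‖ * ‖z‖ := (fderiv ℝ Q (x - X₀)).le_opNorm z
      _ ≤ (M * Ev (x - X₀)) * ‖z‖ := by gcongr; exact (hM _).2.1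
      _ = _ := by ring
  have j1 : Integrable (fun x => bf Q Ψ Y x * af Q Ψ k X₀ x) := (hb Y).integrable_mul (ha X₀)
  have j2 : Integrable (fun x => bf Q Ψ X x * af Q Ψ k X₀ x) := (hb X).integrable_mul (ha X₀)
  have j3 : Integrable (fun x => fderiv ℝ Q (x - X₀) (EuclideanSpace.single k 1)
      * fderiv ℝ Q (x - X₀) (X - Y)) := (hDm _).integrable_mul (hDm _)
  rw [← integral_sub_right_eq_self (fun x => fderiv ℝ Q x (EuclideanSpace.single k 1)
    * fderiv ℝ Q x (X - Y)) X₀]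
  have e : (∫ x, af Q Ψ k X x * bf Q Ψ X₀ x) - (∫ x, af Q Ψ k Y x * bf Q Ψ X₀ x) -
      ∫ x, fderiv ℝ Q (x - X₀) (EuclideanSpace.single k 1) * fderiv ℝ Q (x - X₀) (X - Y)
      = ∫ x, (bf Q Ψ Y x * af Q Ψ k X₀ x - bf Q Ψ X x * af Q Ψ k X₀ x -
      fderiv ℝ Q (x - X₀) (EuclideanSpace.single k 1) * fderiv ℝ Q (x - X₀) (X - Y)) := by
    have j12 : Integrable (fun x => bf Q Ψ Y x * af Q Ψ k X₀ x - bf Q Ψ X x * af Q Ψ k X₀ x) :=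
      j1.sub j2
    rw [integral_sub j12 j3, integral_sub j1 j2]
    linarith
  rw [e, ← Real.norm_eq_abs]
  have e2 : (9 * M ^ 2 * N * ‖X - Y‖) * (η * (∫ x, Ev x ^ 2) + δ * ∫ x, Ev x)
      = ∫ x, (9 * M ^ 2 * N * ‖X - Y‖) * (η * Ev (x - X₀) ^ 2 + δ * Ev (x - X₀)) := by
    rw [integral_sub_right_eq_self
      (fun x => (9 * M ^ 2 * N * ‖X - Y‖) * (η * Ev x ^ 2 + δ * Ev x)) X₀,
      integral_const_mul, integral_add (Ev_int_sq.const_mul _) (Ev_int.const_mul _),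
      integral_const_mul, integral_const_mul]
  rw [e2]
  refine norm_integral_le_of_norm_le ?_ (Filter.Eventually.of_forall fun x =>
    ptw3 hQC2 hM1 hM hΨd hΨ01 hN hη1 hδ0 hX hY hδ k x)
  exact (((Ev_int_sq.const_mul η).add (Ev_int.const_mul δ)).const_mul _).comp_sub_right X₀

lemma mass_est (hQC2 : ContDiff ℝ 2 Q) (hM1 : 1 ≤ M)
    (hM : ∀ x, |Q x| ≤ M * Ev x ∧ ‖fderiv ℝ Q x‖ ≤ M * Ev x ∧
      ‖fderiv ℝ (fderiv ℝ Q) x‖ ≤ M * Ev x)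
    (hΨC : ContDiff ℝ 1 Ψ) (hΨ01 : ∀ x, |Ψ x| ≤ 1) (hN : ∀ x, ‖fderiv ℝ Ψ x‖ + 1 ≤ N)
    {δ : ℝ} (hδ0 : 0 < δ) {X₀ : R3} 
    (hδ : ∀ x, (Ψ x = 1 ∧ fderiv ℝ Ψ x = 0) ∨ Ev (x - X₀) ≤ δ) :
    |(∫ x, bf Q Ψ X₀ x * bf Q Ψ X₀ x) - ∫ x, Q x ^ 2| ≤ M ^ 2 * δ * ∫ x, Ev x := by
  have hb := bf_memLp hQC2 hM1 hM hΨC hΨ01 hN X₀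
  have hQm : MemLp (fun x => Q (x - X₀)) 2 volume :=
    memLp_of_Ev (hQC2.continuous.comp (continuous_sub_right X₀)) M X₀ fun x => (hM _).1
  have j1 : Integrable (fun x => bf Q Ψ X₀ x * bf Q Ψ X₀ x) := hb.integrable_mul hb
  have j2 : Integrable (fun x => Q (x - X₀) ^ 2) := hQm.integrable_sq
  rw [← integral_sub_right_eq_self (fun x => Q x ^ 2) X₀, ← integral_sub j1 j2,
    ← Real.norm_eq_abs, ← integral_sub_right_eq_self Ev X₀, ← integral_const_mul]
  refine norm_integral_le_of_norm_le ((Ev_int.comp_sub_right X₀).const_mul _)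
    (Filter.Eventually.of_forall fun x => ?_)
  have hE := Ev_pos (x - X₀)
  have e : bf Q Ψ X₀ x * bf Q Ψ X₀ x - Q (x - X₀) ^ 2 = Q (x - X₀) * Q (x - X₀) * (Ψ x * Ψ x - 1) := by
    unfold bf; ring
  rw [e, Real.norm_eq_abs]
  rcases hδ x with ⟨h1, h2⟩ | h
  · rw [h1]; simp; positivity
  · have h1 : |Ψ x * Ψ x - 1| ≤ 1 := by
      have := abs_le.1 (hΨ01 x)
      rw [abs_le]; constructor <;> nlinarith
    refine (abs_mul_le' (abs_mul_le' (hM _).1 (hM _).1) h1).trans ?_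
    have : M ^ 2 * Ev (x - X₀) * Ev (x - X₀) ≤ M ^ 2 * Ev (x - X₀) * δ := by gcongr
    linarith

end

lemma rot_re (z : ℂ) (μ : ℝ) : (z * Complex.exp (-(μ : ℂ) * Complex.I)).re
    = Real.cos μ * z.re + Real.sin μ * z.im := by
  rw [← Complex.ofReal_neg, Complex.mul_re, Complex.exp_ofReal_mul_I_re,
    Complex.exp_ofReal_mul_I_im, Real.cos_neg, Real.sin_neg]
  ring

lemma rot_im (z : ℂ) (μ : ℝ) : (z * Complex.exp (-(μ : ℂ) * Complex.I)).im
    = Real.cos μ * z.im - Real.sin μ * z.re := by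
  rw [← Complex.ofReal_neg, Complex.mul_im, Complex.exp_ofReal_mul_I_re,
    Complex.exp_ofReal_mul_I_im, Real.cos_neg, Real.sin_neg]
  ring

theorem modulation_existence_uniqueness
    (Θ : Set R3) (hΘ : IsCompact Θ)
    (Ψ : R3 → ℝ) (hΨC : ContDiff ℝ (⊤ : ℕ∞) Ψ)
    (hΨbdd : ∀ n : ℕ, ∃ Cn : ℝ, ∀ x : R3, ‖iteratedFDeriv ℝ n Ψ x‖ ≤ Cn)
    (hΨrange : ∀ x : R3, Ψ x ∈ Set.Icc (0 : ℝ) 1)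
    (hΨ0 : ∃ U : Set R3, IsOpen U ∧ Θ ⊆ U ∧ ∀ x ∈ U, Ψ x = 0)
    (hΨ1 : ∃ K : Set R3, IsCompact K ∧ ∀ x ∉ K, Ψ x = 1)
    (Q : R3 → ℝ)
    (hQC2 : ContDiff ℝ 2 Q) (hQpos : ∀ x : R3, 0 < Q x)
    (hQrad : ∃ q : ℝ → ℝ, ∀ x : R3, Q x = q ‖x‖)
    (heq : ∀ x : R3, -Q x + lap Q x + (Q x) ^ 3 = 0)
    (a C₀ : ℝ) (ha : 0 < a) (hC₀ : 0 < C₀)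
    (hdecay : ∀ x : R3, 1 < ‖x‖ →
      |Q x - (a / ‖x‖) * Real.exp (-‖x‖)| ≤ C₀ * Real.exp (-‖x‖) / ‖x‖ ^ ((3 : ℝ) / 2) ∧
      ‖fderiv ℝ Q x‖ + ‖fderiv ℝ (fderiv ℝ Q) x‖ ≤ C₀ * Real.exp (-‖x‖) / ‖x‖) :
    ∃ ε₀ > (0 : ℝ), ∃ η₀ > (0 : ℝ), ∃ R₀ > (0 : ℝ),
      ∀ X₀ : R3, R₀ ≤ ‖X₀‖ →
      ∀ u : R3 → ℂ, MemH10 Θ u →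
        Real.sqrt (H1sq (fun x => u x - ((Q (x - X₀) * Ψ x : ℝ) : ℂ))) < ε₀ →
        ∃! p : R3 × ℝ,
          (|p.2| + ‖p.1 - X₀‖ ≤ η₀) ∧
          (∀ k : Fin 3,
            (∫ x : R3, fderiv ℝ (fun y => Q (y - p.1) * Ψ y) x (EuclideanSpace.single k 1) *
              (u x * Complex.exp (-(p.2 : ℂ) * Complex.I)).re) = 0) ∧
          (∫ x : R3, Q (x - p.1) * Ψ x *
            (u x * Complex.exp (-(p.2 : ℂ) * Complex.I)).im) = 0 := by
  have hΨ1' : ContDiff ℝ 1 Ψ := hΨC.of_le (by exact_mod_cast le_top)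
  have hΨd : Differentiable ℝ Ψ := hΨ1'.differentiable (by norm_num)
  have hΨ01 : ∀ x, |Ψ x| ≤ 1 := fun x => by
    have := hΨrange x
    rw [abs_of_nonneg this.1]; exact this.2
  obtain ⟨C1, hC1⟩ := hΨbdd 1
  set N := C1 + 1 with hNdef
  have hN : ∀ x, ‖fderiv ℝ Ψ x‖ + 1 ≤ N := fun x => by
    have := hC1 x
    rw [norm_iteratedFDeriv_one] at this
    linarith
  have hN1 : 1 ≤ N := by linarith [hN 0, norm_nonneg (fderiv ℝ Ψ 0)]
  obtain ⟨M, hM1, hM⟩ := envelope Q hQC2 hQpos a C₀ ha hC₀ hdecay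
  obtain ⟨B, hB⟩ := gram Q M hQC2 hQpos hM
  obtain ⟨K, hK, hΨK⟩ := hΨ1
  have hQm : MemLp Q 2 volume :=
    memLp_of_Ev hQC2.continuous M 0 fun x => by rw [sub_zero]; exact (hM x).1
  have hmpos : 0 < ∫ x, Q x ^ 2 := by
    rw [integral_pos_iff_support_of_nonneg (fun x => sq_nonneg _) hQm.integrable_sq]
    have : Function.support (fun x => Q x ^ 2) = Set.univ := by
      ext x; simp [(hQpos x).ne']
    rw [this]
    exact isOpen_univ.measure_pos volume ⟨0, trivial⟩
  set e1 := ∫ x, Ev x with he1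
  set e2 := ∫ x, Ev x ^ 2 with he2
  have he1' : 0 ≤ e1 := integral_nonneg fun x => (Ev_pos x).le
  have he2' : 0 ≤ e2 := integral_nonneg fun x => by positivity
  have hM0 : 0 < M := by linarith
  have hN0 : 0 < N := by linarith
  set C := 1 + 3 * M * N * Real.sqrt e2 + 9 * M ^ 2 * N * (e1 + e2) with hCdef
  have hp1 : 0 ≤ 3 * M * N * Real.sqrt e2 := by positivity
  have hp2 : 0 ≤ 9 * M ^ 2 * N * (e1 + e2) := by positivity
  have hC : 1 ≤ C := by linarith
  obtain ⟨ε, hε, η, hη, δ, hδ, hη1, hmod⟩ :=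
    abs_mod (H := Lp ℝ 2 (volume : Measure R3)) B (∫ x, Q x ^ 2) C hmpos hC
  obtain ⟨r, hr⟩ := hK.isBounded.subset_closedBall (0 : R3)
  refine ⟨ε, hε, η, hη, |r| + 1 + |Real.log δ|, by positivity, ?_⟩
  intro X₀ hX₀ u hu hclose
  obtain ⟨hud, hu2, -, -⟩ := hu
  have hdel : ∀ x, (Ψ x = 1 ∧ fderiv ℝ Ψ x = 0) ∨ Ev (x - X₀) ≤ δ := by
    intro x
    by_cases hx : x ∈ K
    · right
      have h1 : ‖x‖ ≤ r := by simpa using hr hx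
      have h2 := norm_sub_norm_le X₀ x
      rw [norm_sub_rev] at h2
      have h3 := neg_abs_le (Real.log δ)
      have h4 := le_abs_self r
      calc Ev (x - X₀) ≤ Real.exp (Real.log δ) := Real.exp_le_exp.2 (by linarith)
        _ = δ := Real.exp_log hδ
    · left
      refine ⟨hΨK x hx, ?_⟩
      have : Ψ =ᶠ[nhds x] fun _ => (1:ℝ) := by
        filter_upwards [hK.isClosed.isOpen_compl.mem_nhds hx] with y hy using hΨK y hy
      rw [this.fderiv_eq]
      simp
  have hbm := bf_memLp hQC2 hM1 hM hΨ1' hΨ01 hN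
  have ham := af_memLp hQC2 hM1 hM hΨ1' hΨ01 hN
  have hum : MemLp u 2 volume :=
    (memLp_two_iff_integrable_sq_norm hud.continuous.aestronglyMeasurable).2 hu2
  have hpm : MemLp (fun x => (u x).re) 2 volume := hum.re
  have hqm : MemLp (fun x => (u x).im) 2 volume := hum.im
  have hvm : MemLp (fun x => u x - ((Q (x - X₀) * Ψ x : ℝ) : ℂ)) 2 volume :=
    hum.sub (hbm X₀).ofReal
  have hv2 := (memLp_two_iff_integrable_sq_norm hvm.1).1 hvm
  have hvε : ∫ x, ‖u x - ((Q (x - X₀) * Ψ x : ℝ) : ℂ)‖ ^ 2 ≤ ε ^ 2 := by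
    have h1 := (Real.sqrt_lt' hε).1 hclose
    unfold H1sq at h1
    have h2 : 0 ≤ ∫ x : R3, ‖fderiv ℝ (fun x => u x - ((Q (x - X₀) * Ψ x : ℝ) : ℂ)) x‖ ^ 2 :=
      integral_nonneg fun x => by positivity
    linarith
  have hI : ∀ {f g : R3 → ℝ}, MemLp f 2 volume → MemLp g 2 volume →
      Integrable (fun x => f x * g x) := fun hf hg => hf.integrable_mul hg
  have key := hmod X₀ (fun k X => (ham k X).toLp _) (fun X => (hbm X).toLp _)
    (hpm.toLp _) (hqm.toLp _) ?_ ?_ ?_ ?_ ?_ ?_ ?_ ?_ ?_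
  · convert key using 2 with P
    refine and_congr_right fun _ => and_congr (forall_congr' fun k => ?_) ?_
    · rw [inner_toLp, inner_toLp, ← integral_const_mul, ← integral_const_mul, ← integral_add
        ((hI (ham k P.1) hpm).const_mul _) ((hI (ham k P.1) hqm).const_mul _)]
      refine Eq.congr (integral_congr_ae (Filter.Eventually.of_forall fun x => ?_)) rfl
      simp only [rot_re, af]
      ring
    · rw [inner_toLp, inner_toLp, ← integral_const_mul, ← integral_const_mul, ← integral_sub
        ((hI (hbm P.1) hqm).const_mul _) ((hI (hbm P.1) hpm).const_mul _)]
      refine Eq.congr (integral_congr_ae (Filter.Eventually.of_forall fun x => ?_)) rfl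
      simp only [rot_im, bf]
      ring
  · intro k X hX
    refine (norm_toLp_le _ (3 * M * N) (by positivity) X₀ fun x =>
      (ptw2 hQC2 hM1 hM hΨd hΨ01 hN hη1 hX hX k x).2.1).trans ?_
    linarith
  · intro X hX
    refine (norm_toLp_le _ (3 * M * N) (by positivity) X₀ fun x =>
      (ptw2 hQC2 hM1 hM hΨd hΨ01 hN hη1 hX hX 0 x).1).trans ?_
    linarith
  · intro k X Y hX hY
    rw [← MemLp.toLp_sub]
    refine (norm_toLp_le _ (3 * M * N * ‖X - Y‖) (by positivity) X₀ fun x =>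
      (ptw2 hQC2 hM1 hM hΨd hΨ01 hN hη1 hX hY k x).2.2.2).trans ?_
    have : 3 * M * N * Real.sqrt e2 * ‖X - Y‖ ≤ C * ‖X - Y‖ := by
      gcongr; linarith
    linarith
  · intro X Y hX hY
    rw [← MemLp.toLp_sub]
    refine (norm_toLp_le _ (3 * M * N * ‖X - Y‖) (by positivity) X₀ fun x =>
      (ptw2 hQC2 hM1 hM hΨd hΨ01 hN hη1 hX hY 0 x).2.2.1).trans ?_
    have : 3 * M * N * Real.sqrt e2 * ‖X - Y‖ ≤ C * ‖X - Y‖ := by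
      gcongr; linarith
    linarith
  · intro k X Y hX hY
    rw [inner_toLp, inner_toLp, hB]
    refine (main_est hQC2 hM1 hM hΨ1' hΨ01 hN hη1 hδ hX hY hdel k).trans ?_
    rw [← he1, ← he2]
    have h1 : η * e2 + δ * e1 ≤ (e1 + e2) * (η + δ) := by nlinarith [mul_nonneg hη.le he1', mul_nonneg hδ.le he2']
    calc 9 * M ^ 2 * N * ‖X - Y‖ * (η * e2 + δ * e1)
        ≤ 9 * M ^ 2 * N * ‖X - Y‖ * ((e1 + e2) * (η + δ)) := by gcongr
      _ = (9 * M ^ 2 * N * (e1 + e2)) * (η + δ) * ‖X - Y‖ := by ring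
      _ ≤ C * (η + δ) * ‖X - Y‖ := by gcongr; linarith
  · intro k
    rw [inner_toLp]
    have := ibp hQC2 hM1 hM hΨ1' hΨ01 hN k X₀ X₀
    have h2 : ∫ x, bf Q Ψ X₀ x * af Q Ψ k X₀ x = ∫ x, af Q Ψ k X₀ x * bf Q Ψ X₀ x := by
      simp only [mul_comm]
    linarith
  · rw [inner_toLp]
    refine (mass_est hQC2 hM1 hM hΨ1' hΨ01 hN hδ hdel).trans ?_
    rw [← he1]
    have h1 : M ^ 2 * e1 ≤ 9 * M ^ 2 * N * (e1 + e2) := by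
      calc M ^ 2 * e1 = (1 * M ^ 2 * 1) * e1 := by ring
        _ ≤ (9 * M ^ 2 * N) * (e1 + e2) := by gcongr <;> linarith
    calc M ^ 2 * δ * e1 = (M ^ 2 * e1) * δ := by ring
      _ ≤ C * δ := by gcongr; linarith
  · rw [← MemLp.toLp_sub]
    refine le_of_sq_le_sq ?_ hε.le
    rw [norm_toLp_sq]
    refine le_trans (integral_mono (hpm.sub (hbm X₀)).integrable_sq hv2 fun x => ?_) hvε
    have h1 := Complex.abs_re_le_norm (u x - ((Q (x - X₀) * Ψ x : ℝ) : ℂ))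
    rw [Complex.sub_re, Complex.ofReal_re] at h1
    show ((u x).re - bf Q Ψ X₀ x) ^ 2 ≤ _
    rw [← sq_abs]
    exact pow_le_pow_left₀ (abs_nonneg _) h1 2
  · refine le_of_sq_le_sq ?_ hε.le
    rw [norm_toLp_sq]
    refine le_trans (integral_mono hqm.integrable_sq hv2 fun x => ?_) hvε
    have h1 := Complex.abs_im_le_norm (u x - ((Q (x - X₀) * Ψ x : ℝ) : ℂ))
    rw [Complex.sub_im, Complex.ofReal_im, sub_zero] at h1
    show (u x).im ^ 2 ≤ _
    rw [← sq_abs]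
    exact pow_le_pow_left₀ (abs_nonneg _) h1 2
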